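/- arXiv:1906.11357 — 5 statements merged into one kernel-verified Lean document; each statement's English description precedes it below -/
import Mathlib

section
/- Let f : ℝ^d → ℝ be twice differentiable with ‖∇²f(x)‖ ≤ λ_f and let A : ℝ^d → ℝ^m have twice differentiable components with ‖∇²A_i(x)‖ ≤ λ_A for every i ≤ m and every x (spectral norms). Then for every β > 0, y ∈ ℝ^m and x ∈ ℝ^d, the Hessian of the augmented Lagrangian obeys the spectral-norm bound ‖∇²_x 𝓛_β(x, y)‖ ≤ λ_f + √m · λ_A · (‖y‖ + β ‖A(x)‖) + β ‖DA(x)‖_F², where ‖·‖_F denotes the Frobenius norm. -/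
open InnerProductSpace in
/-- The gradient of the augmented Lagrangian in its primal variable. -/
theorem hasGradientAt_augmentedLagrangian {E ι : Type*} [NormedAddCommGroup E]
    [InnerProductSpace ℝ E] [CompleteSpace E] [Fintype ι] {f : E → ℝ} {A : ι → E → ℝ} {z : E}
    (hf : DifferentiableAt ℝ f z) (hA : ∀ i, DifferentiableAt ℝ (A i) z) (β : ℝ) (y : ι → ℝ) :
    HasGradientAt (fun z => f z + ∑ i, A i z * y i + β / 2 * ∑ i, (A i z) ^ 2)
      (gradient f z + ∑ i, (y i + β * A i z) • gradient (A i) z) z := by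
  have hA' i : HasFDerivAt (A i) (toDual ℝ E (gradient (A i) z)) z :=
    (hA i).hasGradientAt.hasFDerivAt
  rw [hasGradientAt_iff_hasFDerivAt]
  refine ((hf.hasGradientAt.hasFDerivAt.add
    (HasFDerivAt.fun_sum fun i _ => (hA' i).mul_const (y i))).add
    ((HasFDerivAt.fun_sum fun i _ => (hA' i).pow 2).const_mul (β / 2))).congr_fderiv ?_
  ext v
  simp only [map_add, map_sum, map_smul, add_apply,
    sum_apply, smul_apply, smul_eq_mul, Finset.mul_sum,
    add_assoc, ← Finset.sum_add_distrib]
  congr 1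
  refine Finset.sum_congr rfl fun i _ => ?_
  simp
  ring

/-- The Hessian of the augmented Lagrangian in its primal variable. -/
theorem hasFDerivAt_gradient_augmentedLagrangian {E ι : Type*} [NormedAddCommGroup E]
    [InnerProductSpace ℝ E] [CompleteSpace E] [Fintype ι] {f : E → ℝ} {A : ι → E → ℝ}
    (hf : Differentiable ℝ f) (hA : ∀ i, Differentiable ℝ (A i)) {x : E}
    (hf' : DifferentiableAt ℝ (gradient f) x)
    (hA' : ∀ i, DifferentiableAt ℝ (gradient (A i)) x) (β : ℝ) (y : ι → ℝ) :
    HasFDerivAt (gradient (fun z => f z + ∑ i, A i z * y i + β / 2 * ∑ i, (A i z) ^ 2))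
      (fderiv ℝ (gradient f) x + ∑ i, ((y i + β * A i x) • fderiv ℝ (gradient (A i)) x +
        (β • fderiv ℝ (A i) x).smulRight (gradient (A i) x))) x := by
  rw [funext fun z =>
    (hasGradientAt_augmentedLagrangian (hf z) (fun i => hA i z) β y).gradient]
  exact hf'.hasFDerivAt.add (HasFDerivAt.fun_sum fun i _ =>
    ((((hA i x).hasFDerivAt.const_mul β).const_add (y i)).smul (hA' i).hasFDerivAt))

/-- The gradient has the same norm as the Fréchet derivative. -/
theorem norm_gradient_eq_norm_fderiv {E : Type*} [NormedAddCommGroup E]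
    [InnerProductSpace ℝ E] [CompleteSpace E] (f : E → ℝ) (x : E) :
    ‖gradient f x‖ = ‖fderiv ℝ f x‖ := by
  simp [gradient]

/-- The `ℓ¹` norm is at most `√m` times the `ℓ²` norm. -/
theorem sum_abs_le_sqrt_card_mul_sqrt_sum_sq {m : ℕ} (c : Fin m → ℝ) :
    ∑ i, |c i| ≤ √m * √(∑ i, c i ^ 2) := by
  rw [← Real.sqrt_mul (Nat.cast_nonneg m)]
  refine Real.le_sqrt_of_sq_le ?_
  simpa using sq_sum_le_card_mul_sum_sq (s := Finset.univ) (f := fun i => |c i|)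

/-- Spectral-norm bound on the Hessian of the augmented Lagrangian:
`‖∇²_x 𝓛_β(x,y)‖ ≤ λ_f + √m λ_A (‖y‖ + β‖A(x)‖) + β ‖DA(x)‖_F²`,
where `‖A(x)‖ = √(Σᵢ Aᵢ(x)²)` and `‖DA(x)‖_F² = Σᵢ ‖∇Aᵢ(x)‖²`. -/
theorem stmt_2 {d m : ℕ} (f : EuclideanSpace ℝ (Fin d) → ℝ)
    (A : Fin m → EuclideanSpace ℝ (Fin d) → ℝ)
    (lamf lamA : ℝ)
    (hf : Differentiable ℝ f) (hf' : Differentiable ℝ (gradient f))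
    (hA : ∀ i, Differentiable ℝ (A i)) (hA' : ∀ i, Differentiable ℝ (gradient (A i)))
    (hfH : ∀ x, ‖fderiv ℝ (gradient f) x‖ ≤ lamf)
    (hAH : ∀ i x, ‖fderiv ℝ (gradient (A i)) x‖ ≤ lamA)
    (β : ℝ) (hβ : 0 < β) (y : EuclideanSpace ℝ (Fin m)) (x : EuclideanSpace ℝ (Fin d)) :
    ‖fderiv ℝ (gradient (fun z => f z + ∑ i, A i z * y i + β / 2 * ∑ i, (A i z) ^ 2)) x‖
      ≤ lamf + Real.sqrt m * lamA * (‖y‖ + β * Real.sqrt (∑ i, (A i x) ^ 2))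
        + β * ∑ i, ‖gradient (A i) x‖ ^ 2 := by
  rw [(hasFDerivAt_gradient_augmentedLagrangian hf hA (hf' x) (fun i => hA' i x) β y).fderiv]
  have hterm i : ‖(y i + β * A i x) • fderiv ℝ (gradient (A i)) x +
      (β • fderiv ℝ (A i) x).smulRight (gradient (A i) x)‖
      ≤ (|y i| + β * |A i x|) * lamA + β * ‖gradient (A i) x‖ ^ 2 := by
    refine (norm_add_le _ _).trans (add_le_add ?_ ?_)
    · rw [norm_smul, Real.norm_eq_abs]
      refine mul_le_mul ?_ (hAH i x) (norm_nonneg _) (by positivity)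
      refine (abs_add_le _ _).trans_eq ?_
      rw [abs_mul, abs_of_pos hβ]
    · rw [ContinuousLinearMap.norm_smulRight_apply, norm_smul, ← norm_gradient_eq_norm_fderiv,
        Real.norm_of_nonneg hβ.le, sq, mul_assoc]
  have hcoeff : (∑ i, (|y i| + β * |A i x|)) * lamA
      ≤ √m * lamA * (‖y‖ + β * √(∑ i, (A i x) ^ 2)) := by
    rcases Nat.eq_zero_or_pos m with rfl | hm
    · simp
    have hlamA : 0 ≤ lamA := (norm_nonneg _).trans (hAH ⟨0, hm⟩ x)
    have hy : ∑ i, |y i| ≤ √m * ‖y‖ := by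
      simpa [EuclideanSpace.norm_eq] using sum_abs_le_sqrt_card_mul_sqrt_sum_sq y
    have hAx := mul_le_mul_of_nonneg_left
      (sum_abs_le_sqrt_card_mul_sqrt_sum_sq fun i => A i x) hβ.le
    rw [Finset.sum_add_distrib, ← Finset.mul_sum]
    exact (mul_le_mul_of_nonneg_right (add_le_add hy hAx) hlamA).trans_eq (by ring)
  calc _ ≤ lamf + ∑ i, ((|y i| + β * |A i x|) * lamA + β * ‖gradient (A i) x‖ ^ 2) :=
        (norm_add_le _ _).trans (add_le_add (hfH x) (norm_sum_le_of_le _ fun i _ => hterm i))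
    _ = lamf + (∑ i, (|y i| + β * |A i x|)) * lamA + β * ∑ i, ‖gradient (A i) x‖ ^ 2 := by
        rw [Finset.sum_add_distrib, Finset.sum_mul, Finset.mul_sum, add_assoc]
    _ ≤ _ := by gcongr
end

section
/- (Feasibility gap bound.) Let f : ℝ^d → ℝ be differentiable, A : ℝ^d → ℝ^m differentiable, and g : ℝ^d → ℝ convex with subdifferential ∂g. Fix β > 0, ν > 0, ε ≥ 0, y ∈ ℝ^m and x ∈ ℝ^d. Assume (i) near-stationarity: dist(−∇f(x) − DA(x)ᵀy − β DA(x)ᵀA(x), ∂g(x)) ≤ ε, and (ii) regularity: ν ‖A(x)‖ ≤ dist(−DA(x)ᵀA(x), ∂g(x)/β), where ∂g(x)/β := {z/β : z ∈ ∂g(x)}. Then ‖A(x)‖ ≤ (‖∇f(x)‖ + ‖DA(x)‖ ‖y‖ + ε) / (ν β). -/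
open scoped RealInnerProductSpace

/-- The subdifferential of a convex function `g` at `x`. -/
def subdiff {d : ℕ} (g : EuclideanSpace ℝ (Fin d) → ℝ) (x : EuclideanSpace ℝ (Fin d)) :
    Set (EuclideanSpace ℝ (Fin d)) :=
  {v | ∀ z, g x + ⟪v, z - x⟫ ≤ g z}

/-- Feasibility gap bound. Under near-stationarity
`dist(−∇f(x) − DA(x)ᵀy − β DA(x)ᵀA(x), ∂g(x)) ≤ ε` and regularity
`ν‖A(x)‖ ≤ dist(−DA(x)ᵀA(x), ∂g(x)/β)`, one has
`‖A(x)‖ ≤ (‖∇f(x)‖ + ‖DA(x)‖‖y‖ + ε)/(νβ)`. -/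
theorem stmt_4 {d m : ℕ} (f : EuclideanSpace ℝ (Fin d) → ℝ)
    (A : EuclideanSpace ℝ (Fin d) → EuclideanSpace ℝ (Fin m))
    (g : EuclideanSpace ℝ (Fin d) → ℝ)
    (hf : Differentiable ℝ f) (hA : Differentiable ℝ A)
    (hg : ConvexOn ℝ Set.univ g)
    (β ν ε : ℝ) (hβ : 0 < β) (hν : 0 < ν) (hε : 0 ≤ ε)
    (y : EuclideanSpace ℝ (Fin m)) (x : EuclideanSpace ℝ (Fin d))
    (h1 : Metric.infDist
      (-gradient f x - ContinuousLinearMap.adjoint (fderiv ℝ A x) y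
        - β • ContinuousLinearMap.adjoint (fderiv ℝ A x) (A x))
      (subdiff g x) ≤ ε)
    (h2 : ν * ‖A x‖ ≤ Metric.infDist
      (-(ContinuousLinearMap.adjoint (fderiv ℝ A x) (A x)))
      ((fun z => β⁻¹ • z) '' subdiff g x)) :
    ‖A x‖ ≤ (‖gradient f x‖ + ‖fderiv ℝ A x‖ * ‖y‖ + ε) / (ν * β) := by
  set L := ContinuousLinearMap.adjoint (fderiv ℝ A x) with hL
  have scale : Metric.infDist (-(L (A x))) ((fun z => β⁻¹ • z) '' subdiff g x)
      = β⁻¹ * Metric.infDist (-(β • L (A x))) (subdiff g x) := by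
    have h := infDist_smul₀ (inv_ne_zero hβ.ne') (subdiff g x) (-(β • L (A x)))
    rwa [smul_neg, inv_smul_smul₀ hβ.ne', Real.norm_of_nonneg (inv_nonneg.2 hβ.le),
      ← Set.image_smul] at h
  have perturb : dist (-(β • L (A x))) (-gradient f x - L y - β • L (A x))
      ≤ ‖gradient f x‖ + ‖fderiv ℝ A x‖ * ‖y‖ := by
    rw [dist_eq_norm, show -(β • L (A x)) - (-gradient f x - L y - β • L (A x))
      = gradient f x + L y by abel]
    have hLy : ‖L y‖ ≤ ‖fderiv ℝ A x‖ * ‖y‖ := by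
      simpa [hL] using L.le_opNorm y
    exact (norm_add_le _ _).trans (by gcongr)
  have tri := Metric.infDist_le_infDist_add_dist (s := subdiff g x)
    (x := -(β • L (A x))) (y := -gradient f x - L y - β • L (A x))
  rw [scale, inv_mul_eq_div, le_div_iff₀ hβ] at h2
  rw [le_div_iff₀ (mul_pos hν hβ)]
  linarith
end

section
/- (Per-iterate second-order convergence bound, Theorem 1, second case.) Let f : ℝ^d → ℝ be twice differentiable and let A : ℝ^d → ℝ^m have twice differentiable components with ‖∇²A_i(x)‖ ≤ λ_A for every i. Fix β > 0, ν > 0, ε ≥ 0, σ ≥ 0, y ∈ ℝ^m, x ∈ ℝ^d, and constants λ'_f, λ'_A, y_max ≥ 0. Assume (i) ‖A(x)‖ ≤ 2(λ'_f + λ'_A y_max)/(ν β); (ii) λ_min(∇²_x 𝓛_β(x, y)) ≥ −ε. Then, with y' := y + σ A(x), λ_min(∇²_x 𝓛_β(x, y')) ≥ −ε − 2 σ √m λ_A (λ'_f + λ'_A y_max) / (ν β). -/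
open scoped RealInnerProductSpace

/-- The smallest eigenvalue of a symmetric operator `T`, as the infimum of the
Rayleigh quotient `⟪Tv, v⟫` over the unit sphere. -/
noncomputable def lambdaMin {d : ℕ}
    (T : EuclideanSpace ℝ (Fin d) →L[ℝ] EuclideanSpace ℝ (Fin d)) : ℝ :=
  ⨅ v : {v : EuclideanSpace ℝ (Fin d) // ‖v‖ = 1}, ⟪T v.1, v.1⟫

/-- The gradient of the augmented Lagrangian. -/
theorem gradient_augmentedLagrangian {E : Type*} [NormedAddCommGroup E] [InnerProductSpace ℝ E]
    [CompleteSpace E] {m : ℕ} {f : E → ℝ} {A : Fin m → E → ℝ}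
    (hf : Differentiable ℝ f) (hA : ∀ i, Differentiable ℝ (A i)) (β : ℝ) (y : Fin m → ℝ) :
    gradient (fun z => f z + ∑ i, A i z * y i + β / 2 * ∑ i, (A i z) ^ 2) =
      fun z => gradient f z + ∑ i, (y i + β * A i z) • gradient (A i) z := by
  funext z
  apply HasGradientAt.gradient
  have h1 := (hf z).hasGradientAt.hasFDerivAt
  have h2 := fun i => (hA i z).hasGradientAt.hasFDerivAt
  have h := (h1.add (HasFDerivAt.fun_sum (u := Finset.univ)
    fun i _ => (h2 i).mul_const (y i))).add
    ((HasFDerivAt.fun_sum (u := Finset.univ) fun i _ => (h2 i).pow 2).const_mul (β / 2))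
  rw [hasGradientAt_iff_hasFDerivAt]
  refine h.congr_fderiv ?_
  ext v
  simp [Finset.mul_sum, add_assoc, ← Finset.sum_add_distrib]
  refine Finset.sum_congr rfl fun i _ => ?_
  ring

theorem abs_inner_apply_self_le {E : Type*} [NormedAddCommGroup E] [InnerProductSpace ℝ E]
    (T : E →L[ℝ] E) {v : E} (hv : ‖v‖ = 1) : |⟪T v, v⟫| ≤ ‖T‖ := by
  have h1 := abs_real_inner_le_norm (T v) v
  have h2 := T.le_opNorm v
  rw [hv, mul_one] at h1 h2
  exact h1.trans h2

theorem lambdaMin_le_inner {d : ℕ}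
    (T : EuclideanSpace ℝ (Fin d) →L[ℝ] EuclideanSpace ℝ (Fin d))
    {v : EuclideanSpace ℝ (Fin d)} (hv : ‖v‖ = 1) : lambdaMin T ≤ ⟪T v, v⟫ := by
  refine ciInf_le (f := fun v : {v : EuclideanSpace ℝ (Fin d) // ‖v‖ = 1} => ⟪T v.1, v.1⟫)
    ⟨-‖T‖, ?_⟩ ⟨v, hv⟩
  rintro _ ⟨w, rfl⟩
  exact (abs_le.1 (abs_inner_apply_self_le T w.2)).1

/-- The Hessian of the augmented Lagrangian is affine in the dual variable. -/
theorem fderiv_gradient_augmentedLagrangian_add {E : Type*} [NormedAddCommGroup E]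
    [InnerProductSpace ℝ E] [CompleteSpace E] {m : ℕ} {f : E → ℝ} {A : Fin m → E → ℝ}
    (hf : Differentiable ℝ f) (hf' : Differentiable ℝ (gradient f))
    (hA : ∀ i, Differentiable ℝ (A i)) (hA' : ∀ i, Differentiable ℝ (gradient (A i)))
    (β : ℝ) (y w : Fin m → ℝ) (x : E) :
    fderiv ℝ (gradient
        (fun z => f z + ∑ i, A i z * (y i + w i) + β / 2 * ∑ i, (A i z) ^ 2)) x =
      fderiv ℝ (gradient (fun z => f z + ∑ i, A i z * y i + β / 2 * ∑ i, (A i z) ^ 2)) x +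
        ∑ i, w i • fderiv ℝ (gradient (A i)) x := by
  rw [gradient_augmentedLagrangian hf hA β (fun i => y i + w i),
    gradient_augmentedLagrangian hf hA β y]
  have hd : DifferentiableAt ℝ
      (fun z => gradient f z + ∑ i, (y i + β * A i z) • gradient (A i) z) x := by
    fun_prop
  have hs := HasFDerivAt.fun_sum (u := Finset.univ)
    fun i _ => ((hA' i x).hasFDerivAt.const_smul (w i))
  rw [← (hd.hasFDerivAt.add hs).fderiv]
  congr 1
  funext z
  simp only [Pi.add_apply, Pi.smul_apply, add_assoc, ← Finset.sum_add_distrib, ← add_smul]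
  congr 1
  refine Finset.sum_congr rfl fun i _ => ?_
  congr 1
  ring

theorem sum_abs_le_sqrt_card_mul_sqrt_sum_sq_s10 {ι : Type*} [Fintype ι] (a : ι → ℝ) :
    ∑ i, |a i| ≤ √(Fintype.card ι) * √(∑ i, a i ^ 2) := by
  rw [← Real.sqrt_mul (Nat.cast_nonneg _)]
  apply Real.le_sqrt_of_sq_le
  simpa using sq_sum_le_card_mul_sum_sq (s := Finset.univ) (f := fun i => |a i|)

/-- Per-iterate second-order convergence bound; Theorem 1, second case.
If `‖A(x)‖ ≤ 2(λ'_f + λ'_A y_max)/(νβ)` and `λ_min(∇²_x 𝓛_β(x,y)) ≥ −ε`, then with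
`y' = y + σ A(x)`,
`λ_min(∇²_x 𝓛_β(x,y')) ≥ −ε − 2σ√m λ_A (λ'_f + λ'_A y_max)/(νβ)`. -/
theorem stmt_10 {d m : ℕ} (f : EuclideanSpace ℝ (Fin d) → ℝ)
    (A : Fin m → EuclideanSpace ℝ (Fin d) → ℝ) (lamA : ℝ)
    (hf : Differentiable ℝ f) (hf' : Differentiable ℝ (gradient f))
    (hA : ∀ i, Differentiable ℝ (A i)) (hA' : ∀ i, Differentiable ℝ (gradient (A i)))
    (hAH : ∀ i x, ‖fderiv ℝ (gradient (A i)) x‖ ≤ lamA)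
    (β ν ε σ lf' lA' ymax : ℝ)
    (hβ : 0 < β) (hν : 0 < ν) (hε : 0 ≤ ε) (hσ : 0 ≤ σ)
    (hlf' : 0 ≤ lf') (hlA' : 0 ≤ lA') (hymax : 0 ≤ ymax)
    (y : Fin m → ℝ) (x : EuclideanSpace ℝ (Fin d))
    (hAx : Real.sqrt (∑ i, (A i x) ^ 2) ≤ 2 * (lf' + lA' * ymax) / (ν * β))
    (hmin : -ε ≤ lambdaMin (fderiv ℝ (gradient
        (fun z => f z + ∑ i, A i z * y i + β / 2 * ∑ i, (A i z) ^ 2)) x)) :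
    -ε - 2 * σ * Real.sqrt m * lamA * (lf' + lA' * ymax) / (ν * β)
      ≤ lambdaMin (fderiv ℝ (gradient
          (fun z => f z + ∑ i, A i z * (y i + σ * A i x) + β / 2 * ∑ i, (A i z) ^ 2)) x) := by
  have hB : 0 ≤ 2 * (lf' + lA' * ymax) / (ν * β) := (Real.sqrt_nonneg _).trans hAx
  have hlam : 0 ≤ √(m : ℝ) * lamA := by
    rcases Nat.eq_zero_or_pos m with rfl | hm
    · simp
    · exact mul_nonneg (Real.sqrt_nonneg _) ((norm_nonneg _).trans (hAH ⟨0, hm⟩ x))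
  have hsplit : 2 * σ * √(m : ℝ) * lamA * (lf' + lA' * ymax) / (ν * β) =
      σ * (√(m : ℝ) * lamA * (2 * (lf' + lA' * ymax) / (ν * β))) := by ring
  rw [hsplit]
  have hC := mul_nonneg hσ (mul_nonneg hlam hB)
  rw [fderiv_gradient_augmentedLagrangian_add hf hf' hA hA' β y (fun i => σ * A i x) x]
  generalize fderiv ℝ (gradient
    (fun z => f z + ∑ i, A i z * y i + β / 2 * ∑ i, (A i z) ^ 2)) x = T at hmin ⊢
  rcases isEmpty_or_nonempty {v : EuclideanSpace ℝ (Fin d) // ‖v‖ = 1} with hE | hE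
  · rw [lambdaMin, Real.iInf_of_isEmpty]
    linarith
  refine le_ciInf fun ⟨v, hv⟩ => ?_
  have hT := hmin.trans (lambdaMin_le_inner T hv)
  have hsum : |∑ i, A i x * ⟪fderiv ℝ (gradient (A i)) x v, v⟫| ≤
      √(m : ℝ) * lamA * (2 * (lf' + lA' * ymax) / (ν * β)) := by
    calc |∑ i, A i x * ⟪fderiv ℝ (gradient (A i)) x v, v⟫|
        ≤ ∑ i, |A i x| * lamA := by
          refine (Finset.abs_sum_le_sum_abs _ _).trans (Finset.sum_le_sum fun i _ => ?_)
          rw [abs_mul]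
          exact mul_le_mul_of_nonneg_left
            ((abs_inner_apply_self_le _ hv).trans (hAH i x)) (abs_nonneg _)
      _ ≤ √(m : ℝ) * lamA * √(∑ i, (A i x) ^ 2) := by
          rcases Nat.eq_zero_or_pos m with rfl | hm
          · simp
          · have hl : 0 ≤ lamA := (norm_nonneg _).trans (hAH ⟨0, hm⟩ x)
            have h := sum_abs_le_sqrt_card_mul_sqrt_sum_sq_s10 fun i => A i x
            rw [Fintype.card_fin] at h
            rw [← Finset.sum_mul, mul_right_comm]
            exact mul_le_mul_of_nonneg_right h hl
      _ ≤ _ := mul_le_mul_of_nonneg_left hAx hlam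
  have hinner : ⟪(T + ∑ i, (σ * A i x) • fderiv ℝ (gradient (A i)) x) v, v⟫ =
      ⟪T v, v⟫ + σ * ∑ i, A i x * ⟪fderiv ℝ (gradient (A i)) x v, v⟫ := by
    simp [inner_add_left, sum_inner, inner_smul_left, Finset.mul_sum, mul_assoc]
  have hlow := mul_le_mul_of_nonneg_left (abs_le.1 hsum).1 hσ
  change _ ≤ ⟪(T + ∑ i, (σ * A i x) • fderiv ℝ (gradient (A i)) x) v, v⟫
  rw [hinner]
  linarith
end

section
/- (Equivalence of basis pursuit and its nonconvex relaxation.) Let B ∈ ℝ^{n×d} and b ∈ ℝ^n. Then inf{‖z‖_1 : z ∈ ℝ^d, Bz = b} = inf{‖u_1‖² + ‖u_2‖² : u_1, u_2 ∈ ℝ^d, B(u_1 ∘ u_1 − u_2 ∘ u_2) = b}, where ∘ denotes the entrywise product; in particular one infimum is finite if and only if the other is, and feasible points on one side map to feasible points on the other with matching objective values achievable in the limit. -/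
/-- Every vector is a difference of entrywise squares whose total mass is its `ℓ¹` norm. -/
theorem exists_sq_sub_sq_eq_and_sum_eq_sum_abs {ι : Type*} [Fintype ι] (z : ι → ℝ) :
    ∃ u₁ u₂ : ι → ℝ, (fun i => u₁ i ^ 2 - u₂ i ^ 2) = z ∧
      ∑ i, |z i| = ∑ i, u₁ i ^ 2 + ∑ i, u₂ i ^ 2 := by
  have hpos (i : ι) : √(z i)⁺ ^ 2 = (z i)⁺ := Real.sq_sqrt (posPart_nonneg _)
  have hneg (i : ι) : √(z i)⁻ ^ 2 = (z i)⁻ := Real.sq_sqrt (negPart_nonneg _)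
  refine ⟨fun i => √(z i)⁺, fun i => √(z i)⁻, ?_, ?_⟩
  · funext i
    simp only [hpos, hneg, posPart_sub_negPart]
  · simp only [hpos, hneg, ← Finset.sum_add_distrib, posPart_add_negPart]

/-- The `ℓ¹` norm of a difference of entrywise squares is at most the total mass. -/
theorem sum_abs_sq_sub_sq_le {ι : Type*} [Fintype ι] (u₁ u₂ : ι → ℝ) :
    ∑ i, |u₁ i ^ 2 - u₂ i ^ 2| ≤ ∑ i, u₁ i ^ 2 + ∑ i, u₂ i ^ 2 := by
  rw [← Finset.sum_add_distrib]
  refine Finset.sum_le_sum fun i _ => ?_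
  rw [abs_le]
  constructor <;> linarith [sq_nonneg (u₁ i), sq_nonneg (u₂ i)]

/-- If `S ⊆ T` and every element of `T` dominates one of `S`, the infima agree. -/
theorem csInf_eq_of_subset_of_forall_exists_le {S T : Set ℝ} (hS : BddBelow S) (hST : S ⊆ T)
    (hTS : ∀ t ∈ T, ∃ s ∈ S, s ≤ t) : sInf S = sInf T := by
  rcases T.eq_empty_or_nonempty with rfl | hT
  · rw [Set.subset_empty_iff.mp hST]
  have hSne : S.Nonempty := let ⟨t, ht⟩ := hT; let ⟨s, hs, _⟩ := hTS t ht; ⟨s, hs⟩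
  have hle : ∀ t ∈ T, sInf S ≤ t := fun t ht =>
    let ⟨_, hs, hst⟩ := hTS t ht
    (csInf_le hS hs).trans hst
  exact le_antisymm (le_csInf hT hle) (csInf_le_csInf ⟨_, hle⟩ hSne hST)

/-- Equivalence of basis pursuit and its nonconvex relaxation.
`inf{‖z‖₁ : Bz = b} = inf{‖u₁‖² + ‖u₂‖² : B(u₁∘u₁ − u₂∘u₂) = b}`; in particular
one feasible (hence value) set is nonempty iff the other is. -/
theorem stmt_16 {n d : ℕ} (B : Matrix (Fin n) (Fin d) ℝ) (b : Fin n → ℝ) :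
    sInf {t : ℝ | ∃ z : Fin d → ℝ, B.mulVec z = b ∧ t = ∑ i, |z i|} =
      sInf {t : ℝ | ∃ u₁ u₂ : Fin d → ℝ,
        B.mulVec (fun i => u₁ i ^ 2 - u₂ i ^ 2) = b ∧
        t = ∑ i, u₁ i ^ 2 + ∑ i, u₂ i ^ 2} ∧
    ({t : ℝ | ∃ z : Fin d → ℝ, B.mulVec z = b ∧ t = ∑ i, |z i|}.Nonempty ↔
      {t : ℝ | ∃ u₁ u₂ : Fin d → ℝ,
        B.mulVec (fun i => u₁ i ^ 2 - u₂ i ^ 2) = b ∧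
        t = ∑ i, u₁ i ^ 2 + ∑ i, u₂ i ^ 2}.Nonempty) := by
  have hsub : {t : ℝ | ∃ z : Fin d → ℝ, B.mulVec z = b ∧ t = ∑ i, |z i|} ⊆
      {t : ℝ | ∃ u₁ u₂ : Fin d → ℝ,
        B.mulVec (fun i => u₁ i ^ 2 - u₂ i ^ 2) = b ∧
        t = ∑ i, u₁ i ^ 2 + ∑ i, u₂ i ^ 2} := by
    rintro _ ⟨z, hz, rfl⟩
    obtain ⟨u₁, u₂, hu, hsum⟩ := exists_sq_sub_sq_eq_and_sum_eq_sum_abs z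
    exact ⟨u₁, u₂, by rw [hu, hz], hsum⟩
  refine ⟨csInf_eq_of_subset_of_forall_exists_le ⟨0, ?_⟩ hsub ?_,
    fun h => h.mono hsub, ?_⟩
  · rintro _ ⟨z, -, rfl⟩
    positivity
  · rintro _ ⟨u₁, u₂, hu, rfl⟩
    exact ⟨_, ⟨_, hu, rfl⟩, sum_abs_sq_sub_sq_le u₁ u₂⟩
  · rintro ⟨_, u₁, u₂, hu, -⟩
    exact ⟨_, _, hu, rfl⟩
end

section
/- (Regularity for the generalized eigenvalue constraint.) Let B ∈ ℝ^{n×n} be symmetric positive definite with smallest eigenvalue η_min(B) > 0, and define A(x) := xᵀ B x − 1 for x ∈ ℝ^n. Then A is differentiable with ∇A(x) = 2Bx, and for every x ∈ ℝ^n, ‖∇A(x) · A(x)‖ = 2 |xᵀ B x − 1| · ‖Bx‖ ≥ η_min(B) · ‖x‖ · |xᵀ B x − 1|. In particular, for any ν₀ > 0, the regularity inequality ν ‖A(x)‖ ≤ ‖∇A(x) · A(x)‖ holds with ν = η_min(B) ν₀ for all x with ‖x‖ ≥ ν₀. -/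
/-- The constraint `A(x) = xᵀBx − 1` of the nonconvex generalized eigenvalue
formulation, on `EuclideanSpace ℝ (Fin n)`. -/
noncomputable def quadA {n : ℕ} (B : Matrix (Fin n) (Fin n) ℝ)
    (x : EuclideanSpace ℝ (Fin n)) : ℝ :=
  (∑ i, x i * ∑ j, B i j * x j) - 1

/-- Multiplication by a symmetric matrix scales each coordinate in the eigenvector basis by the
corresponding eigenvalue. -/
theorem Matrix.IsHermitian.inner_eigenvectorBasis_toEuclideanCLM {n : ℕ}
    {B : Matrix (Fin n) (Fin n) ℝ} (hB : B.IsHermitian) (i : Fin n)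
    (x : EuclideanSpace ℝ (Fin n)) :
    inner ℝ (hB.eigenvectorBasis i) (Matrix.toEuclideanCLM (𝕜 := ℝ) B x)
      = hB.eigenvalues i * inner ℝ (hB.eigenvectorBasis i) x := by
  have hself : IsSelfAdjoint (Matrix.toEuclideanCLM (n := Fin n) (𝕜 := ℝ) B) :=
    IsSelfAdjoint.map hB.isSelfAdjoint _
  have heig : Matrix.toEuclideanCLM (𝕜 := ℝ) B (hB.eigenvectorBasis i)
      = hB.eigenvalues i • hB.eigenvectorBasis i := by
    ext j
    simpa using congrFun (hB.mulVec_eigenvectorBasis i) j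
  have hsymm := hself.isSymmetric (hB.eigenvectorBasis i) x
  simp only [ContinuousLinearMap.coe_coe] at hsymm
  rw [← hsymm, heig, real_inner_smul_left]

/-- The smallest eigenvalue, when nonnegative, bounds the norm of `B x` from below. -/
theorem Matrix.IsHermitian.iInf_eigenvalues_mul_norm_le {n : ℕ}
    {B : Matrix (Fin n) (Fin n) ℝ} (hB : B.IsHermitian) (h0 : 0 ≤ ⨅ i, hB.eigenvalues i)
    (x : EuclideanSpace ℝ (Fin n)) :
    (⨅ i, hB.eigenvalues i) * ‖x‖ ≤ ‖Matrix.toEuclideanCLM (𝕜 := ℝ) B x‖ := by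
  refine le_of_sq_le_sq ?_ (norm_nonneg _)
  rw [mul_pow, ← hB.eigenvectorBasis.sum_sq_norm_inner_right x,
    ← hB.eigenvectorBasis.sum_sq_norm_inner_right (Matrix.toEuclideanCLM (𝕜 := ℝ) B x),
    Finset.mul_sum]
  refine Finset.sum_le_sum fun i _ => ?_
  rw [hB.inner_eigenvectorBasis_toEuclideanCLM, norm_mul, mul_pow]
  gcongr
  exact (ciInf_le (Set.finite_range hB.eigenvalues).bddBelow i).trans (le_abs_self _)

theorem toEuclideanCLM_apply_eq_sum {n : ℕ} (B : Matrix (Fin n) (Fin n) ℝ)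
    (x : EuclideanSpace ℝ (Fin n)) (i : Fin n) :
    Matrix.toEuclideanCLM (𝕜 := ℝ) B x i = ∑ j, B i j * x j := by
  simp [Matrix.mulVec, dotProduct]

theorem quadA_eq_inner {n : ℕ} (B : Matrix (Fin n) (Fin n) ℝ) :
    quadA B = fun x => inner ℝ x (Matrix.toEuclideanCLM (𝕜 := ℝ) B x) - 1 := by
  ext x
  simp [quadA, PiLp.inner_apply, Matrix.mulVec, dotProduct, mul_comm]

theorem hasGradientAt_quadA {n : ℕ} {B : Matrix (Fin n) (Fin n) ℝ} (hB : B.IsHermitian)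
    (x : EuclideanSpace ℝ (Fin n)) :
    HasGradientAt (quadA B) ((2 : ℝ) • Matrix.toEuclideanCLM (𝕜 := ℝ) B x) x := by
  have hself : IsSelfAdjoint (Matrix.toEuclideanCLM (n := Fin n) (𝕜 := ℝ) B) :=
    IsSelfAdjoint.map hB.isSelfAdjoint _
  rw [hasGradientAt_iff_hasFDerivAt, quadA_eq_inner]
  refine (((hasFDerivAt_id x).inner ℝ
    (Matrix.toEuclideanCLM (n := Fin n) (𝕜 := ℝ) B).hasFDerivAt).sub_const 1).congr_fderiv ?_
  ext1 y
  have hsymm := hself.isSymmetric x y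
  simp only [ContinuousLinearMap.coe_coe] at hsymm
  simp [fderivInnerCLM_apply, ← hsymm,
    real_inner_comm (Matrix.toEuclideanCLM (n := Fin n) (𝕜 := ℝ) B x) y, two_mul]

/-- Regularity for the generalized eigenvalue constraint.
For symmetric positive definite `B` with smallest eigenvalue `η_min(B) > 0` and
`A(x) = xᵀBx − 1`: `A` is differentiable with `∇A(x) = 2Bx`,
`‖∇A(x)·A(x)‖ = 2|xᵀBx − 1|‖Bx‖ ≥ η_min(B)‖x‖|xᵀBx − 1|`, and for any `ν₀ > 0`
the regularity inequality `ν‖A(x)‖ ≤ ‖∇A(x)·A(x)‖` holds with `ν = η_min(B)ν₀`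
whenever `‖x‖ ≥ ν₀`. -/
theorem stmt_17 {n : ℕ} (B : Matrix (Fin n) (Fin n) ℝ) (hB : B.PosDef)
    (hη : 0 < ⨅ i, hB.isHermitian.eigenvalues i) :
    Differentiable ℝ (quadA B) ∧
    (∀ (x : EuclideanSpace ℝ (Fin n)) (i : Fin n),
      gradient (quadA B) x i = 2 * ∑ j, B i j * x j) ∧
    (∀ x : EuclideanSpace ℝ (Fin n),
      ‖quadA B x • gradient (quadA B) x‖
        = 2 * |quadA B x| * Real.sqrt (∑ i, (∑ j, B i j * x j) ^ 2)) ∧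
    (∀ x : EuclideanSpace ℝ (Fin n),
      (⨅ i, hB.isHermitian.eigenvalues i) * ‖x‖ * |quadA B x|
        ≤ ‖quadA B x • gradient (quadA B) x‖) ∧
    (∀ ν₀ : ℝ, 0 < ν₀ → ∀ x : EuclideanSpace ℝ (Fin n), ν₀ ≤ ‖x‖ →
      (⨅ i, hB.isHermitian.eigenvalues i) * ν₀ * |quadA B x|
        ≤ ‖quadA B x • gradient (quadA B) x‖) := by
  have hgrad := fun x => (hasGradientAt_quadA hB.isHermitian x).gradient
  have hnorm : ∀ x : EuclideanSpace ℝ (Fin n), ‖quadA B x • gradient (quadA B) x‖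
      = 2 * |quadA B x| * ‖Matrix.toEuclideanCLM (𝕜 := ℝ) B x‖ := fun x => by
    rw [hgrad, norm_smul, norm_smul, Real.norm_eq_abs, Real.norm_eq_abs, abs_two]
    ring
  have hbound : ∀ x : EuclideanSpace ℝ (Fin n),
      (⨅ i, hB.isHermitian.eigenvalues i) * ‖x‖ * |quadA B x|
        ≤ ‖quadA B x • gradient (quadA B) x‖ := fun x => by
    have hle := mul_le_mul_of_nonneg_right
      (hB.isHermitian.iInf_eigenvalues_mul_norm_le hη.le x) (abs_nonneg (quadA B x))
    have hpos := mul_nonneg (abs_nonneg (quadA B x))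
      (norm_nonneg (Matrix.toEuclideanCLM (n := Fin n) (𝕜 := ℝ) B x))
    rw [hnorm]
    linarith
  refine ⟨fun x => (hasGradientAt_quadA hB.isHermitian x).hasFDerivAt.differentiableAt,
    fun x i => ?_, fun x => ?_, hbound, fun ν₀ _ x hx => le_trans ?_ (hbound x)⟩
  · rw [hgrad, PiLp.smul_apply, toEuclideanCLM_apply_eq_sum, smul_eq_mul]
  · simp_rw [hnorm, EuclideanSpace.norm_eq, toEuclideanCLM_apply_eq_sum, Real.norm_eq_abs, sq_abs]
  · gcongr
end
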